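/- arXiv:2602.11382 — 2 statements merged into one kernel-verified Lean document; each statement's English description precedes it below -/
import Mathlib

section
/- Let n ≥ 2 and let C = ((i_0, j_0), …, (i_{q−1}, j_{q−1})), with i_l < j_l, be a sorting network for ℝⁿ in q comparators. Let S be the nonnegative matrix with rows indexed by the nonempty proper subsets J of [n], columns indexed by the permutations σ of [n], and entries S_{J,σ} = Σ_{j ∈ J} σ(j) − |J|(|J|+1)/2. Then S has nonnegative rank at most 2q: explicitly, S = A·B where A is indexed by pairs (l, ε) with l ∈ {0,…,q−1}, ε ∈ {−1, +1}, with A_{J,(l,ε)} = 𝟙[ε(l, J) = ε], where ε(l, J) := 𝟙[j_l ∈ J_l and i_l ∉ J_l] − 𝟙[i_l ∈ J_l and j_l ∉ J_l] (the sets J_l being defined by J_0 = J and χ_{J_{l+1}} = σ⁻_{i_l,j_l}(χ_{J_l})), and B_{(l,ε),σ} = (ε·(σ_l(j_l) − σ_l(i_l)))₊, where σ_0 = σ and x_{σ_{l+1}} = σ⁺_{i_l,j_l}(x_{σ_l}), and a₊ := max{0, a}. -/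
noncomputable section

/-- Conditional reflection `σ⁺_{i,j}`: replaces `(x i, x j)` by `(min, max)`. -/
def sigP {n : ℕ} (i j : Fin n) (x : Fin n → ℝ) : Fin n → ℝ :=
  fun k => if k = i then min (x i) (x j) else if k = j then max (x i) (x j) else x k

/-- Conditional reflection `σ⁻_{i,j}`: replaces `(x i, x j)` by `(max, min)`. -/
def sigM {n : ℕ} (i j : Fin n) (x : Fin n → ℝ) : Fin n → ℝ :=
  fun k => if k = i then max (x i) (x j) else if k = j then min (x i) (x j) else x k

/-- `σ⁺_C = σ⁺_{i_{q-1},j_{q-1}} ∘ ⋯ ∘ σ⁺_{i_0,j_0}`. -/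
def netP {n : ℕ} (C : List (Fin n × Fin n)) (x : Fin n → ℝ) : Fin n → ℝ :=
  C.foldl (fun y p => sigP p.1 p.2 y) x

/-- `σ⁻_C = σ⁻_{i_{q-1},j_{q-1}} ∘ ⋯ ∘ σ⁻_{i_0,j_0}`. -/
def netM {n : ℕ} (C : List (Fin n × Fin n)) (x : Fin n → ℝ) : Fin n → ℝ :=
  C.foldl (fun y p => sigM p.1 p.2 y) x

/-- Characteristic vector of `J ⊆ [n]`. -/
def chi {n : ℕ} (J : Finset (Fin n)) : Fin n → ℝ :=
  fun k => if k ∈ J then 1 else 0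

/-- The vector `x_σ = (σ(1), …, σ(n))`. -/
def permVec {n : ℕ} (σ : Equiv.Perm (Fin n)) : Fin n → ℝ :=
  fun k => ((σ k : ℕ) : ℝ) + 1

/-- The sign `ε ∈ {−1,+1}` encoded by a boolean. -/
def epsval : Bool → ℝ := fun b => if b then 1 else -1

/-- `ε(l,J) = 𝟙[j_l ∈ J_l, i_l ∉ J_l] − 𝟙[i_l ∈ J_l, j_l ∉ J_l]`, where
`χ_{J_l} = netM (C.take l) (chi J)`. -/
def epsfun {n : ℕ} (C : List (Fin n × Fin n)) (l : Fin C.length)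
    (J : Finset (Fin n)) : ℝ :=
  (if netM (C.take l.1) (chi J) (C.get l).2 = 1
      ∧ netM (C.take l.1) (chi J) (C.get l).1 = 0 then (1 : ℝ) else 0)
  - (if netM (C.take l.1) (chi J) (C.get l).1 = 1
      ∧ netM (C.take l.1) (chi J) (C.get l).2 = 0 then (1 : ℝ) else 0)

/-- The left factor `A_{J,(l,ε)} = 𝟙[ε(l,J) = ε]`. -/
def Amat {n : ℕ} (C : List (Fin n × Fin n)) (J : Finset (Fin n))
    (l : Fin C.length) (ε : Bool) : ℝ :=
  if epsfun C l J = epsval ε then 1 else 0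

/-- The right factor `B_{(l,ε),σ} = (ε · (σ_l(j_l) − σ_l(i_l)))₊`, where
`x_{σ_l} = netP (C.take l) (permVec σ)`. -/
def Bmat {n : ℕ} (C : List (Fin n × Fin n)) (l : Fin C.length) (ε : Bool)
    (σ : Equiv.Perm (Fin n)) : ℝ :=
  max 0 (epsval ε * (netP (C.take l.1) (permVec σ) (C.get l).2
      - netP (C.take l.1) (permVec σ) (C.get l).1))

theorem sigM_eq_neg_sigP {n : ℕ} (i j : Fin n) (x : Fin n → ℝ) :
    sigM i j x = -sigP i j (-x) := by
  funext k
  simp only [sigM, sigP, Pi.neg_apply, min_neg_neg, max_neg_neg]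
  split_ifs <;> simp

theorem netM_eq_neg_netP {n : ℕ} (C : List (Fin n × Fin n)) (x : Fin n → ℝ) :
    netM C x = -netP C (-x) := by
  induction C generalizing x with
  | nil => simp [netM, netP]
  | cons p C ih =>
    have h := ih (sigM p.1 p.2 x)
    rw [sigM_eq_neg_sigP, neg_neg] at h
    simpa only [netM, netP, List.foldl_cons, sigM_eq_neg_sigP p.1 p.2 x] using h

theorem sigM_zero_or_one {n : ℕ} (i j : Fin n) {y : Fin n → ℝ}
    (hy : ∀ k, y k = 0 ∨ y k = 1) (k : Fin n) : sigM i j y k = 0 ∨ sigM i j y k = 1 := by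
  rcases hy i with h₁ | h₁ <;> rcases hy j with h₂ | h₂ <;>
    simp only [sigM, h₁, h₂] <;> split_ifs <;> simp [hy k]

theorem netM_zero_or_one {n : ℕ} (C : List (Fin n × Fin n)) {y : Fin n → ℝ}
    (hy : ∀ k, y k = 0 ∨ y k = 1) (k : Fin n) : netM C y k = 0 ∨ netM C y k = 1 := by
  induction C generalizing y with
  | nil => exact hy k
  | cons p C ih => exact ih (sigM_zero_or_one p.1 p.2 hy)

theorem chi_zero_or_one {n : ℕ} (J : Finset (Fin n)) (k : Fin n) :
    chi J k = 0 ∨ chi J k = 1 := by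
  by_cases h : k ∈ J <;> simp [chi, h]

theorem netM_take_succ {n : ℕ} (C : List (Fin n × Fin n)) (l : Fin C.length) (x : Fin n → ℝ) :
    netM (C.take (l + 1)) x = sigM (C.get l).1 (C.get l).2 (netM (C.take l) x) := by
  rw [List.take_succ_eq_append_getElem l.2]
  simp only [netM, List.foldl_append, List.foldl_cons, List.foldl_nil, List.get_eq_getElem]

theorem netP_take_succ {n : ℕ} (C : List (Fin n × Fin n)) (l : Fin C.length) (x : Fin n → ℝ) :
    netP (C.take (l + 1)) x = sigP (C.get l).1 (C.get l).2 (netP (C.take l) x) := by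
  rw [List.take_succ_eq_append_getElem l.2]
  simp only [netP, List.foldl_append, List.foldl_cons, List.foldl_nil, List.get_eq_getElem]

/-- A comparator changes the pairing of two vectors only through its two coordinates. -/
theorem sum_mul_sub_sum_sigM_mul_sigP {n : ℕ} {i j : Fin n} (hij : i ≠ j) (x y : Fin n → ℝ) :
    ∑ k, y k * x k - ∑ k, sigM i j y k * sigP i j x k
      = y i * x i + y j * x j
        - (max (y i) (y j) * min (x i) (x j) + min (y i) (y j) * max (x i) (x j)) := by
  rw [← Finset.sum_sub_distrib, Fintype.sum_eq_add i j hij]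
  · simp only [sigM, sigP, if_true, if_neg hij.symm]
    ring
  · rintro k ⟨hi, hj⟩
    simp [sigM, sigP, hi, hj]

/-- The loss in the pairing at comparator `l` is the contribution of `l` to the product `A·B`. -/
theorem sum_Amat_mul_Bmat {n : ℕ} (C : List (Fin n × Fin n)) (hC : ∀ p ∈ C, p.1 < p.2)
    (J : Finset (Fin n)) (σ : Equiv.Perm (Fin n)) (l : Fin C.length) :
    ∑ ε : Bool, Amat C J l ε * Bmat C l ε σ
      = ∑ k, netM (C.take l) (chi J) k * netP (C.take l) (permVec σ) k
        - ∑ k, netM (C.take (l + 1)) (chi J) k * netP (C.take (l + 1)) (permVec σ) k := by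
  have hij := (hC _ (C.get_mem l)).ne
  have h01 := netM_zero_or_one (C.take l) (chi_zero_or_one J)
  rw [netM_take_succ, netP_take_succ, sum_mul_sub_sum_sigM_mul_sigP hij]
  simp only [Fintype.sum_bool, Amat, Bmat, epsfun, epsval]
  generalize netP (C.take l) (permVec σ) = x
  rcases h01 (C.get l).1 with hi | hi <;> rcases h01 (C.get l).2 with hj | hj <;>
    rcases le_total (x (C.get l).1) (x (C.get l).2) with h | h <;>
    simp only [hi, hj] <;> simp only [List.get_eq_getElem] at h ⊢ <;>
    norm_num [h, add_comm]

theorem Finset.eq_range_card_of_isLowerSet (s : Finset ℕ) (hs : IsLowerSet (s : Set ℕ)) :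
    s = Finset.range s.card := by
  refine Finset.eq_of_subset_of_card_le (fun k hk => ?_) (by simp)
  have h : Finset.range (k + 1) ⊆ s := fun m hm =>
    hs (Nat.lt_succ_iff.mp (Finset.mem_range.mp hm)) hk
  simpa [Nat.succ_le_iff] using Finset.card_le_card h

theorem sum_range_cast_add_one (m : ℕ) :
    ∑ k ∈ Finset.range m, ((k : ℝ) + 1) = (m : ℝ) * ((m : ℝ) + 1) / 2 := by
  induction m with
  | zero => simp
  | succ m ih =>
    rw [Finset.sum_range_succ, ih]
    push_cast
    ring

theorem permVec_eq_of_monotone {n : ℕ} (σ : Equiv.Perm (Fin n)) (h : Monotone (permVec σ)) :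
    permVec σ = fun k : Fin n => ((k : ℕ) : ℝ) + 1 := by
  have hmono : Monotone σ := fun a b hab => by
    have := h hab
    simpa [permVec] using this
  have hσ : (σ : Fin n → Fin n) = id :=
    ((hmono.strictMono_of_injective σ.injective).range_inj strictMono_id).mp (by simp)
  funext k
  simp [permVec, hσ]

theorem sum_mul_eq_of_antitone_chi {n : ℕ} (J : Finset (Fin n)) (h : Antitone (chi J)) :
    ∑ k, chi J k * (((k : ℕ) : ℝ) + 1) = (J.card : ℝ) * ((J.card : ℝ) + 1) / 2 := by
  have hlow : IsLowerSet ((J.map Fin.valEmbedding : Finset ℕ) : Set ℕ) := by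
    intro a b hba ha
    simp only [Finset.coe_map, Set.mem_image, Finset.mem_coe, Fin.valEmbedding_apply] at ha ⊢
    obtain ⟨k, hk, rfl⟩ := ha
    refine ⟨⟨b, hba.trans_lt k.2⟩, ?_, rfl⟩
    by_contra hb
    have := h (show (⟨b, hba.trans_lt k.2⟩ : Fin n) ≤ k from hba)
    simp only [chi, hk, hb, if_true, if_false] at this
    linarith
  have hrange := Finset.eq_range_card_of_isLowerSet _ hlow
  rw [Finset.card_map] at hrange
  rw [← sum_range_cast_add_one, ← hrange, Finset.sum_map]
  simp [chi]

theorem chi_comp_perm {n : ℕ} (J : Finset (Fin n)) (π : Equiv.Perm (Fin n)) :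
    chi J ∘ π = chi (J.map π.symm.toEmbedding) := by
  funext k
  simp [chi]

/-- A sorting network pairs the sorted permutation vector with an initial segment. -/
theorem sum_netM_chi_mul_netP_permVec {n : ℕ} (C : List (Fin n × Fin n))
    (hsort : ∀ x : Fin n → ℝ, Monotone (netP C x) ∧
      ∃ π : Equiv.Perm (Fin n), netP C x = x ∘ π)
    (J : Finset (Fin n)) (σ : Equiv.Perm (Fin n)) :
    ∑ k, netM C (chi J) k * netP C (permVec σ) k = (J.card : ℝ) * ((J.card : ℝ) + 1) / 2 := by
  obtain ⟨hx, π, hπ⟩ := hsort (permVec σ)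
  obtain ⟨hy, τ, hτ⟩ := hsort (-chi J)
  have hP : netP C (permVec σ) = permVec (π.trans σ) := hπ
  have hM : netM C (chi J) = chi (J.map τ.symm.toEmbedding) := by
    rw [netM_eq_neg_netP, hτ, ← chi_comp_perm]
    funext k
    simp
  have hanti : Antitone (netM C (chi J)) := by
    rw [netM_eq_neg_netP]
    exact hy.neg
  rw [hP] at hx ⊢
  rw [hM] at hanti ⊢
  rw [permVec_eq_of_monotone _ hx, sum_mul_eq_of_antitone_chi _ hanti, Finset.card_map]

/-- The slack matrix of the permutahedron has nonnegative rank at most `2q`: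
the explicit nonnegative factorization `S = A·B` arising from a sorting network
in `q` comparators. -/
theorem stmt10 (n : ℕ) (hn : 2 ≤ n) (C : List (Fin n × Fin n))
    (hC : ∀ p ∈ C, p.1 < p.2)
    (hsort : ∀ x : Fin n → ℝ, Monotone (netP C x) ∧
      ∃ π : Equiv.Perm (Fin n), netP C x = x ∘ π) :
    (∀ (J : Finset (Fin n)) (l : Fin C.length) (ε : Bool), 0 ≤ Amat C J l ε)
    ∧ (∀ (l : Fin C.length) (ε : Bool) (σ : Equiv.Perm (Fin n)), 0 ≤ Bmat C l ε σ)
    ∧ (∀ J : Finset (Fin n), J.Nonempty → J ≠ Finset.univ →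
        ∀ σ : Equiv.Perm (Fin n),
          (∑ j ∈ J, (((σ j : ℕ) : ℝ) + 1)) - (J.card : ℝ) * ((J.card : ℝ) + 1) / 2
            = ∑ l : Fin C.length, ∑ ε : Bool, Amat C J l ε * Bmat C l ε σ) := by
  refine ⟨fun J l ε => ?_, fun l ε σ => le_max_left _ _, fun J _ _ σ => ?_⟩
  · unfold Amat
    split_ifs <;> norm_num
  · simp only [sum_Amat_mul_Bmat C hC J σ]
    rw [Fin.sum_univ_eq_sum_range (fun l =>
        ∑ k, netM (C.take l) (chi J) k * netP (C.take l) (permVec σ) k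
          - ∑ k, netM (C.take (l + 1)) (chi J) k * netP (C.take (l + 1)) (permVec σ) k),
      Finset.sum_range_sub', List.take_length, sum_netM_chi_mul_netP_permVec C hsort]
    simp [netM, netP, chi, permVec]
end
end

section
/- Let n ≥ 2 and let C be the sequence of coordinate pairs of length q = n(n−1)/2 given by listing, for i = 1, 2, …, n−1 in increasing order, the pairs (i, n), (i, n−1), …, (i, i+1) (j decreasing from n to i+1). Then: (a) C is a sorting network for ℝⁿ, i.e. the composition σ⁺_C of the conditional reflections σ⁺_{i_l,j_l} taken in this order maps every x ∈ ℝⁿ to its nondecreasing rearrangement; and (b) C is minimal: for every proper subsequence D of C (obtained by deleting at least one pair, keeping the order of the others), σ⁺_D is not a sorting network. -/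
noncomputable section

/-- One comparator given by a pair of (0-indexed) natural-number coordinates. -/
def stepN (n : ℕ) (p : ℕ × ℕ) (x : Fin n → ℝ) : Fin n → ℝ :=
  if h : p.1 < n ∧ p.2 < n then sigP ⟨p.1, h.1⟩ ⟨p.2, h.2⟩ x else x

/-- Composition of the comparators of `C`, first entry applied first. -/
def netN (n : ℕ) (C : List (ℕ × ℕ)) (x : Fin n → ℝ) : Fin n → ℝ :=
  C.foldl (fun y p => stepN n p y) x

/-- `C` is a sorting network for `ℝⁿ`: it maps every vector to its
nondecreasing rearrangement. -/
def IsSortNetN (n : ℕ) (C : List (ℕ × ℕ)) : Prop :=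
  ∀ x : Fin n → ℝ, Monotone (netN n C x) ∧
    ∃ π : Equiv.Perm (Fin n), netN n C x = x ∘ π

/-- The quadratic network: for `i = 0, …, n−2` (0-indexed) in increasing order,
the comparators `(i, n−1), (i, n−2), …, (i, i+1)` with second coordinate
decreasing. (In the paper's 1-indexed notation: for `i = 1, …, n−1`, the pairs
`(i, n), (i, n−1), …, (i, i+1)`.) -/
def bubbleC (n : ℕ) : List (ℕ × ℕ) :=
  ((List.range (n - 1)).map (fun i =>
    (List.range (n - 1 - i)).map (fun t => (i, n - 1 - t)))).flatten

theorem netN_cons (n : ℕ) (p : ℕ × ℕ) (C : List (ℕ × ℕ)) (x : Fin n → ℝ) :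
    netN n (p :: C) x = netN n C (stepN n p x) := rfl

theorem netN_append (n : ℕ) (C D : List (ℕ × ℕ)) (x : Fin n → ℝ) :
    netN n (C ++ D) x = netN n D (netN n C x) :=
  List.foldl_append

theorem sigP_eq_comp_perm {n : ℕ} (i j : Fin n) (x : Fin n → ℝ) :
    ∃ π : Equiv.Perm (Fin n), sigP i j x = x ∘ π := by
  rcases le_total (x i) (x j) with h | h
  · refine ⟨1, funext fun k => ?_⟩
    simp only [sigP, Function.comp, Equiv.Perm.one_apply, min_eq_left h, max_eq_right h]
    split_ifs <;> simp_all
  · refine ⟨Equiv.swap i j, funext fun k => ?_⟩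
    simp only [sigP, Function.comp, Equiv.swap_apply_def, min_eq_right h, max_eq_left h]
    split_ifs <;> rfl

theorem stepN_eq_comp_perm (n : ℕ) (p : ℕ × ℕ) (x : Fin n → ℝ) :
    ∃ π : Equiv.Perm (Fin n), stepN n p x = x ∘ π := by
  unfold stepN
  split_ifs
  · exact sigP_eq_comp_perm _ _ x
  · exact ⟨1, rfl⟩

theorem netN_eq_comp_perm (n : ℕ) (C : List (ℕ × ℕ)) (x : Fin n → ℝ) :
    ∃ π : Equiv.Perm (Fin n), netN n C x = x ∘ π := by
  induction C generalizing x with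
  | nil => exact ⟨1, rfl⟩
  | cons p C ih =>
    obtain ⟨π, hπ⟩ := stepN_eq_comp_perm n p x
    obtain ⟨ρ, hρ⟩ := ih (stepN n p x)
    exact ⟨π * ρ, by rw [netN_cons, hρ, hπ]; rfl⟩

/-- `y` is sorted as far as rows `0, …, i - 1` and the last `t` comparators of row `i` ensure. -/
def SortedUpTo (n i t : ℕ) (y : Fin n → ℝ) : Prop :=
  ∀ k l : Fin n, k < l → ((k : ℕ) < i ∨ (k : ℕ) = i ∧ n - 1 - t < l) → y k ≤ y l

theorem SortedUpTo.stepN {n i t : ℕ} (ht : t < n - 1 - i) {y : Fin n → ℝ}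
    (hy : SortedUpTo n i t y) : SortedUpTo n i (t + 1) (stepN n (i, n - 1 - t) y) := by
  intro k l hkl h
  have hi : i < n := by omega
  have hj : n - 1 - t < n := by omega
  have hij : i < n - 1 - t := by omega
  have hki := hy k ⟨i, hi⟩
  have hkj := hy k ⟨n - 1 - t, hj⟩
  have hkl' := hy k l hkl
  simp only [_root_.stepN, hi, hj, and_self, dite_true, sigP, Fin.ext_iff, Fin.lt_def] at *
  rcases h with h | ⟨rfl, h⟩
  · have h1 := hki h (Or.inl h)
    have h2 := hkj (by omega) (Or.inl h)
    have h3 := hkl' (Or.inl h)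
    rw [if_neg (by omega), if_neg (by omega)]
    split_ifs
    · exact le_min h1 h2
    · exact h1.trans (le_max_left _ _)
    · exact h3
  · rw [if_pos rfl, if_neg (by omega)]
    split_ifs with hl
    · exact min_le_max
    · exact (min_le_left _ _).trans (hkl' (Or.inr ⟨rfl, by omega⟩))

theorem SortedUpTo.row {n i : ℕ} {y : Fin n → ℝ} (hy : SortedUpTo n i 0 y) (t : ℕ)
    (ht : t ≤ n - 1 - i) :
    SortedUpTo n i t (netN n ((List.range t).map fun t => (i, n - 1 - t)) y) := by
  induction t with
  | zero => exact hy
  | succ t ih =>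
    rw [List.range_succ, List.map_append, netN_append]
    exact (ih (by omega)).stepN (by omega)

theorem sortedUpTo_rows (n : ℕ) (x : Fin n → ℝ) (m : ℕ) :
    SortedUpTo n m 0 (netN n ((List.range m).map (fun i =>
      (List.range (n - 1 - i)).map (fun t => (i, n - 1 - t)))).flatten x) := by
  induction m with
  | zero =>
    intro k l _ h
    omega
  | succ m ih =>
    rw [List.range_succ, List.map_append, List.flatten_append, netN_append]
    intro k l hkl h
    simp only [List.map_cons, List.map_nil, List.flatten_cons, List.flatten_nil, List.append_nil]
    refine ih.row (n - 1 - m) le_rfl k l hkl ?_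
    rw [Fin.lt_def] at hkl
    omega

theorem isSortNetN_bubbleC (n : ℕ) : IsSortNetN n (bubbleC n) := by
  refine fun x => ⟨fun k l hkl => ?_, netN_eq_comp_perm n _ x⟩
  rcases hkl.eq_or_lt with rfl | hkl
  · exact le_rfl
  · exact sortedUpTo_rows n x (n - 1) k l hkl (by rw [Fin.lt_def] at hkl; omega)

theorem length_bubbleC (n : ℕ) : (bubbleC n).length = n * (n - 1) / 2 := by
  have h : (bubbleC n).length = ∑ i ∈ Finset.range (n - 1), (n - 1 - i) := by
    simp only [bubbleC, List.length_flatten, List.map_map, Function.comp_def, List.length_map,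
      List.length_range]
    rfl
  rw [h, ← Finset.sum_range_id, ← Finset.sum_range_reflect (fun i => i) n]
  cases n with
  | zero => rfl
  | succ m => simp [Finset.sum_range_succ]

theorem pairwise_bubbleC (n : ℕ) :
    (bubbleC n).Pairwise fun p q => p.1 < q.1 ∨ p.1 = q.1 ∧ q.2 < p.2 := by
  simp only [bubbleC, List.pairwise_flatten, List.mem_map, List.pairwise_map]
  constructor
  · rintro _ ⟨i, -, rfl⟩
    refine List.pairwise_map.2 <| List.pairwise_lt_range.imp_of_mem fun ha hb h => Or.inr ⟨rfl, ?_⟩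
    rw [List.mem_range] at ha hb
    omega
  · refine List.pairwise_lt_range.imp fun h p hp q hq => Or.inl ?_
    obtain ⟨_, -, rfl⟩ := hp
    obtain ⟨_, -, rfl⟩ := hq
    exact h

theorem lt_of_mem_bubbleC {n : ℕ} {p : ℕ × ℕ} (hp : p ∈ bubbleC n) : p.1 < p.2 ∧ p.2 < n := by
  simp only [bubbleC, List.mem_flatten, List.mem_map, List.mem_range] at hp
  obtain ⟨_, ⟨i, hi, rfl⟩, hp⟩ := hp
  simp only [List.mem_map, List.mem_range] at hp
  obtain ⟨t, ht, rfl⟩ := hp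
  dsimp only
  omega

/-- Comparators acting only on coordinates beyond `i` fix all coordinates up to `i`. -/
theorem netN_apply_of_lt {n i : ℕ} (D : List (ℕ × ℕ)) (hD : ∀ p ∈ D, i < p.1 ∧ p.1 < p.2)
    (x : Fin n → ℝ) (k : Fin n) (hk : (k : ℕ) ≤ i) : netN n D x k = x k := by
  induction D generalizing x with
  | nil => rfl
  | cons p D ih =>
    rw [netN_cons, ih (fun q hq => hD q (List.mem_cons_of_mem _ hq))]
    have hp := hD p List.mem_cons_self
    unfold stepN
    split_ifs
    · simp only [sigP, Fin.ext_iff]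
      rw [if_neg (by omega), if_neg (by omega)]
    · rfl

theorem sigP_of_le {n : ℕ} {i j : Fin n} {x : Fin n → ℝ} (h : x i ≤ x j) : sigP i j x = x := by
  funext k
  simp only [sigP, min_eq_left h, max_eq_right h]
  split_ifs <;> simp_all

/-- A vector whose sorting requires the comparator `(i, j)`. -/
def missWitness (n i j : ℕ) : Fin n → ℝ :=
  fun k => if (k : ℕ) < i then k else if (k : ℕ) = j then i else n

theorem stepN_missWitness {n i j : ℕ} {p : ℕ × ℕ} (hij : i < j) (hp : p.1 < p.2)
    (hpi : p.1 ≤ i) (hne : p ≠ (i, j)) : stepN n p (missWitness n i j) = missWitness n i j := by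
  obtain ⟨a, b⟩ := p
  unfold stepN
  split_ifs
  · apply sigP_of_le
    have hb : ¬ (a = i ∧ b = j) := fun h => hne (by rw [h.1, h.2])
    dsimp only [missWitness] at *
    split_ifs <;> exact Nat.cast_le.2 (by omega)
  · rfl

theorem netN_missWitness {n i j : ℕ} (hij : i < j) (D : List (ℕ × ℕ))
    (hs : D.Pairwise fun p q => p.1 ≤ q.1) (hlt : ∀ p ∈ D, p.1 < p.2) (hD : (i, j) ∉ D)
    (k : Fin n) (hk : (k : ℕ) ≤ i) : netN n D (missWitness n i j) k = missWitness n i j k := by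
  induction D with
  | nil => rfl
  | cons p D ih =>
    rw [List.pairwise_cons] at hs
    rw [List.mem_cons, not_or] at hD
    by_cases hpi : p.1 ≤ i
    · rw [netN_cons, stepN_missWitness hij (hlt p List.mem_cons_self) hpi (Ne.symm hD.1)]
      exact ih hs.2 (fun q hq => hlt q (List.mem_cons_of_mem _ hq)) hD.2
    · refine netN_apply_of_lt _ (fun q hq => ⟨?_, hlt q hq⟩) _ k hk
      rcases List.mem_cons.1 hq with rfl | hq
      · omega
      · exact lt_of_lt_of_le (not_le.1 hpi) (hs.1 q hq)

theorem not_isSortNetN_of_notMem {n i j : ℕ} (hij : i < j) (hj : j < n) (D : List (ℕ × ℕ))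
    (hs : D.Pairwise fun p q => p.1 ≤ q.1) (hlt : ∀ p ∈ D, p.1 < p.2) (hD : (i, j) ∉ D) :
    ¬ IsSortNetN n D := by
  intro h
  obtain ⟨hmono, π, hπ⟩ := h (missWitness n i j)
  have hi : i < n := hij.trans hj
  have key := netN_missWitness (n := n) hij D hs hlt hD
  have hval : netN n D (missWitness n i j) (π.symm ⟨j, hj⟩) = i := by
    rw [hπ, Function.comp_apply, Equiv.apply_symm_apply]
    simp [missWitness, hij.not_gt]
  generalize π.symm ⟨j, hj⟩ = m at hval
  rcases lt_or_ge (m : ℕ) i with hm | hm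
  · rw [key m hm.le, missWitness, if_pos hm] at hval
    exact hm.ne (by exact_mod_cast hval)
  · have hle := hmono (show (⟨i, hi⟩ : Fin n) ≤ m from hm)
    rw [hval, key _ le_rfl] at hle
    simp only [missWitness, lt_irrefl, if_false, hij.ne, Nat.cast_le] at hle
    omega

theorem List.Sublist.exists_mem_notMem {α : Type*} {D C : List α} (h : D.Sublist C)
    (hne : D ≠ C) (hC : C.Nodup) : ∃ a ∈ C, a ∉ D := by
  by_contra! hsub
  exact hne (h.eq_of_length_le (hC.subperm hsub).length_le)

/-- The quadratic network has `n(n−1)/2` comparators, is a sorting network, and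
is minimal: no proper subsequence of it is a sorting network. -/
theorem stmt18 (n : ℕ) (hn : 2 ≤ n) :
    (bubbleC n).length = n * (n - 1) / 2 ∧
    IsSortNetN n (bubbleC n) ∧
    ∀ D : List (ℕ × ℕ), D.Sublist (bubbleC n) → D ≠ bubbleC n →
      ¬ IsSortNetN n D := by
  refine ⟨length_bubbleC n, isSortNetN_bubbleC n, fun D hD hne => ?_⟩
  have hpw := pairwise_bubbleC n
  have hnodup : (bubbleC n).Nodup := hpw.imp fun h heq => by subst heq; omega
  obtain ⟨⟨i, j⟩, hmem, hnot⟩ := hD.exists_mem_notMem hne hnodup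
  have hp := lt_of_mem_bubbleC hmem
  exact not_isSortNetN_of_notMem hp.1 hp.2 D ((hpw.sublist hD).imp fun h => by omega)
    (fun p hp => (lt_of_mem_bubbleC (hD.subset hp)).1) hnot
end
end
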